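/- arXiv:2405.07252 — 2 statements merged into one kernel-verified Lean document; each statement's English description precedes it below -/
import Mathlib

section
/- (Theorem 3) For every prior π on F, R_L ≤ R*_N(Θ, Φ) ≤ R_U, where R_L = Σ_φ π(φ) ( D_{c,N}(P_φ ‖ Q_π) − D_{c,N}(P_φ ‖ Θ) ) and R_U = max_{φ in F} ( D_{c,N}(P_φ ‖ Q_π) − D_{c,N}(P_φ ‖ Θ) ). -/
noncomputable section

/-- A model: a strictly positive probability function on `Y^(n+1)`. -/
def IsModel {Y : Type*} [Fintype Y] {n : ℕ} (P : (Fin (n + 1) → Y) → ℝ) : Prop :=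
  (∀ y, 0 < P y) ∧ (∑ y, P y) = 1

/-- A predictor: to every prefix `y^{N-1}` it assigns a strictly positive
probability function on `Y`. -/
def IsPredictor {Y : Type*} [Fintype Y] {n : ℕ} (Q : (Fin n → Y) → Y → ℝ) : Prop :=
  ∀ z, (∀ y, 0 < Q z y) ∧ (∑ y, Q z y) = 1

/-- Marginal probability `P(y^{N-1}) = Σ_y P(y^{N-1}, y)` of a prefix. -/
def prefixProb {Y : Type*} [Fintype Y] {n : ℕ} (P : (Fin (n + 1) → Y) → ℝ)
    (z : Fin n → Y) : ℝ :=
  ∑ y : Y, P (Fin.snoc z y)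

/-- Conditional probability `P(y_N | y^{N-1}) = P(y^N) / P(y^{N-1})`. -/
def condProb {Y : Type*} [Fintype Y] {n : ℕ} (P : (Fin (n + 1) → Y) → ℝ)
    (y : Fin (n + 1) → Y) : ℝ :=
  P y / prefixProb P (Fin.init y)

/-- The regret
`R_N(Pφ, Pθ, Q) = Σ_{y^N} Pφ(y^N) log( Pθ(y_N|y^{N-1}) / Q(y_N|y^{N-1}) )`. -/
def regretN {Y : Type*} [Fintype Y] {n : ℕ} (Pφ Pθ : (Fin (n + 1) → Y) → ℝ)
    (Q : (Fin n → Y) → Y → ℝ) : ℝ :=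
  ∑ y, Pφ y * Real.log (condProb Pθ y / Q (Fin.init y) (y (Fin.last n)))

/-- Conditional KL divergence of a model `P` from a predictor `Q`. -/
def DcPred {Y : Type*} [Fintype Y] {n : ℕ} (P : (Fin (n + 1) → Y) → ℝ)
    (Q : (Fin n → Y) → Y → ℝ) : ℝ :=
  ∑ y, P y * Real.log (condProb P y / Q (Fin.init y) (y (Fin.last n)))

/-- Conditional KL divergence of a model `P` from another model `P'`. -/
def DcModel {Y : Type*} [Fintype Y] {n : ℕ} (P P' : (Fin (n + 1) → Y) → ℝ) : ℝ :=
  ∑ y, P y * Real.log (condProb P y / condProb P' y)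

/-- A prior: a probability vector on the index set `F`. -/
def IsPrior {F : Type*} [Fintype F] (π : F → ℝ) : Prop :=
  (∀ φ, 0 ≤ π φ) ∧ (∑ φ, π φ) = 1

/-- Conditional divergence of a model from the hypothesis class
`Θ = {P θ : θ ∈ G}`: the minimum over `θ ∈ G` of `D_{c,N}(P ‖ P θ)`. -/
def DcSet {Y F : Type*} [Fintype Y] [Fintype F] {n : ℕ}
    (P : F → (Fin (n + 1) → Y) → ℝ) (G : Finset F) (hG : G.Nonempty)
    (Pφ : (Fin (n + 1) → Y) → ℝ) : ℝ :=
  G.inf' hG fun θ => DcModel Pφ (P θ)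

/-- The mixture predictor
`Q_π(y_N | y^{N-1}) = (Σ_φ π(φ) P_φ(y^N)) / (Σ_φ π(φ) P_φ(y^{N-1}))`. -/
def mixPred {Y F : Type*} [Fintype Y] [Fintype F] {n : ℕ}
    (P : F → (Fin (n + 1) → Y) → ℝ) (π : F → ℝ) : (Fin n → Y) → Y → ℝ :=
  fun z y => (∑ φ, π φ * P φ (Fin.snoc z y)) / (∑ φ, π φ * prefixProb (P φ) z)

/-- `I_π(Y_N; Φ | Y^{N-1})`. -/
def mutualInfoN {Y F : Type*} [Fintype Y] [Fintype F] {n : ℕ}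
    (P : F → (Fin (n + 1) → Y) → ℝ) (π : F → ℝ) : ℝ :=
  ∑ φ, ∑ y, π φ * P φ y *
    Real.log (condProb (P φ) y / mixPred P π (Fin.init y) (y (Fin.last n)))

/-- `J(π) = I_π(Y_N; Φ | Y^{N-1}) − Σ_φ π(φ) D_{c,N}(P_φ ‖ Θ)`. -/
def Jfun {Y F : Type*} [Fintype Y] [Fintype F] {n : ℕ}
    (P : F → (Fin (n + 1) → Y) → ℝ) (G : Finset F) (hG : G.Nonempty)
    (π : F → ℝ) : ℝ :=
  mutualInfoN P π - ∑ φ, π φ * DcSet P G hG (P φ)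

/-- The min-max regret
`R*_N(Θ, Φ) = inf_Q max_{φ ∈ F} max_{θ ∈ G} R_N(P_φ, P_θ, Q)`. -/
def Rstar {Y F : Type*} [Fintype Y] [Fintype F] [Nonempty F] {n : ℕ}
    (P : F → (Fin (n + 1) → Y) → ℝ) (G : Finset F) (hG : G.Nonempty) : ℝ :=
  sInf {r : ℝ | ∃ Q, IsPredictor Q ∧
    r = Finset.univ.sup' Finset.univ_nonempty fun φ =>
          G.sup' hG fun θ => regretN (P φ) (P θ) Q}

/-- The conditional capacity `C_{c,N}(Φ) = sup_π I_π(Y_N; Φ | Y^{N-1})`. -/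
def capacityN {Y F : Type*} [Fintype Y] [Fintype F] {n : ℕ}
    (P : F → (Fin (n + 1) → Y) → ℝ) : ℝ :=
  sSup {r : ℝ | ∃ π, IsPrior π ∧ r = mutualInfoN P π}

/-- The binary entropy `h(λ) = −λ log λ − (1−λ) log(1−λ)`
(with `h(0) = h(1) = 0`, using `Real.log 0 = 0`). -/
def binEnt (l : ℝ) : ℝ := -(l * Real.log l) - (1 - l) * Real.log (1 - l)

section Mixture

variable {Y F : Type*} [Fintype Y] [Fintype F] {n : ℕ}

lemma sum_eq_sum_snoc (f : (Fin (n + 1) → Y) → ℝ) :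
    ∑ y, f y = ∑ z : Fin n → Y, ∑ a : Y, f (Fin.snoc z a) := by
  rw [← Fintype.sum_prod_type' (f := fun z a => f (Fin.snoc z a)),
    ← Equiv.sum_comp ((Equiv.prodComm _ _).trans (Fin.snocEquiv fun _ : Fin (n + 1) => Y))]
  rfl

/-- The mixture `∑ φ, π φ * P φ` of a family of models. -/
def mixture (P : F → (Fin (n + 1) → Y) → ℝ) (π : F → ℝ) (y : Fin (n + 1) → Y) : ℝ :=
  ∑ φ, π φ * P φ y

lemma IsModel.prefixProb_pos [Nonempty Y] {P : (Fin (n + 1) → Y) → ℝ} (hP : IsModel P)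
    (z : Fin n → Y) :
    0 < prefixProb P z :=
  Finset.sum_pos (fun _ _ => hP.1 _) Finset.univ_nonempty

lemma IsModel.condProb_pos [Nonempty Y] {P : (Fin (n + 1) → Y) → ℝ} (hP : IsModel P)
    (y : Fin (n + 1) → Y) : 0 < condProb P y :=
  div_pos (hP.1 y) (hP.prefixProb_pos _)

lemma mixture_isModel {P : F → (Fin (n + 1) → Y) → ℝ} (hP : ∀ φ, IsModel (P φ))
    {π : F → ℝ} (hπ : IsPrior π) : IsModel (mixture P π) := by
  constructor
  · intro y
    obtain ⟨φ, -, hφ⟩ : ∃ φ ∈ Finset.univ, 0 < π φ :=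
      Finset.exists_lt_of_sum_lt (f := fun _ => (0 : ℝ)) (by simp [hπ.2])
    exact Finset.sum_pos' (fun φ _ => mul_nonneg (hπ.1 φ) ((hP φ).1 y).le)
      ⟨φ, Finset.mem_univ φ, mul_pos hφ ((hP φ).1 y)⟩
  · simp only [mixture]
    rw [Finset.sum_comm]
    simp [← Finset.mul_sum, (hP _).2, hπ.2]

lemma mixPred_eq (P : F → (Fin (n + 1) → Y) → ℝ) (π : F → ℝ) (z : Fin n → Y) (a : Y) :
    mixPred P π z a = mixture P π (Fin.snoc z a) / prefixProb (mixture P π) z := by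
  simp only [mixPred, mixture, prefixProb, Finset.mul_sum]
  rw [Finset.sum_comm]

lemma mixPred_isPredictor [Nonempty Y] {P : F → (Fin (n + 1) → Y) → ℝ} (hP : ∀ φ, IsModel (P φ))
    {π : F → ℝ} (hπ : IsPrior π) : IsPredictor (mixPred P π) := by
  have hM := mixture_isModel hP hπ
  refine fun z => ⟨fun a => ?_, ?_⟩
  · rw [mixPred_eq]
    exact div_pos (hM.1 _) (hM.prefixProb_pos z)
  · simp only [mixPred_eq, ← Finset.sum_div]
    exact div_self (hM.prefixProb_pos z).ne'

lemma regretN_eq_sub [Nonempty Y] {Pφ Pθ : (Fin (n + 1) → Y) → ℝ} {Q : (Fin n → Y) → Y → ℝ}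
    (hφ : IsModel Pφ) (hθ : IsModel Pθ) (hQ : IsPredictor Q) :
    regretN Pφ Pθ Q = DcPred Pφ Q - DcModel Pφ Pθ := by
  simp only [regretN, DcPred, DcModel, ← Finset.sum_sub_distrib, ← mul_sub]
  refine Finset.sum_congr rfl fun y _ => ?_
  have hq := ((hQ (Fin.init y)).1 (y (Fin.last n))).ne'
  have h₁ := (hφ.condProb_pos y).ne'
  have h₂ := (hθ.condProb_pos y).ne'
  rw [Real.log_div h₂ hq, Real.log_div h₁ hq, Real.log_div h₁ h₂]
  ring

lemma sup'_regretN_eq [Nonempty Y] {P : F → (Fin (n + 1) → Y) → ℝ} (hP : ∀ φ, IsModel (P φ))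
    (G : Finset F) (hG : G.Nonempty) {Q : (Fin n → Y) → Y → ℝ} (hQ : IsPredictor Q) (φ : F) :
    (G.sup' hG fun θ => regretN (P φ) (P θ) Q) = DcPred (P φ) Q - DcSet P G hG (P φ) := by
  simp only [regretN_eq_sub (hP _) (hP _) hQ]
  apply le_antisymm
  · exact Finset.sup'_le _ _ fun θ hθ => sub_le_sub_left
      (Finset.inf'_le (fun θ => DcModel (P φ) (P θ)) hθ) _
  · obtain ⟨θ, hθ, h⟩ := Finset.exists_mem_eq_inf' hG fun θ => DcModel (P φ) (P θ)
    rw [DcSet, h]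
    exact Finset.le_sup' (fun θ => DcPred (P φ) Q - DcModel (P φ) (P θ)) hθ

/-- The mixture predictor minimizes the average conditional divergence. -/
lemma sum_DcPred_mixPred_le [Nonempty Y] {P : F → (Fin (n + 1) → Y) → ℝ} (hP : ∀ φ, IsModel (P φ))
    {π : F → ℝ} (hπ : IsPrior π) {Q : (Fin n → Y) → Y → ℝ} (hQ : IsPredictor Q) :
    ∑ φ, π φ * DcPred (P φ) (mixPred P π) ≤ ∑ φ, π φ * DcPred (P φ) Q := by
  have hM := mixture_isModel hP hπ
  have hR := mixPred_isPredictor hP hπ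
  have key : ∑ φ, π φ * DcPred (P φ) (mixPred P π) - ∑ φ, π φ * DcPred (P φ) Q =
      ∑ y, mixture P π y * Real.log (Q (Fin.init y) (y (Fin.last n)) /
        mixPred P π (Fin.init y) (y (Fin.last n))) := by
    simp only [mixture, Finset.sum_mul]
    rw [Finset.sum_comm, ← Finset.sum_sub_distrib]
    refine Finset.sum_congr rfl fun φ _ => ?_
    simp only [DcPred]
    rw [← mul_sub, ← Finset.sum_sub_distrib, Finset.mul_sum]
    refine Finset.sum_congr rfl fun y _ => ?_
    have hq := ((hQ (Fin.init y)).1 (y (Fin.last n))).ne'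
    have hr := ((hR (Fin.init y)).1 (y (Fin.last n))).ne'
    have h₁ := ((hP φ).condProb_pos y).ne'
    rw [Real.log_div h₁ hq, Real.log_div h₁ hr, Real.log_div hq hr]
    ring
  rw [← sub_nonpos, key, sum_eq_sum_snoc]
  refine Finset.sum_nonpos fun z _ => ?_
  simp only [Fin.init_snoc, Fin.snoc_last]
  calc
    _ ≤ ∑ a, prefixProb (mixture P π) z * (Q z a - mixPred P π z a) := by
      refine Finset.sum_le_sum fun a _ => ?_
      have hq := (hQ z).1 a
      have hr := (hR z).1 a
      have hm : mixture P π (Fin.snoc z a) =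
          prefixProb (mixture P π) z * mixPred P π z a := by
        rw [mixPred_eq, mul_div_cancel₀ _ (hM.prefixProb_pos z).ne']
      calc
        _ ≤ mixture P π (Fin.snoc z a) * (Q z a / mixPred P π z a - 1) :=
          mul_le_mul_of_nonneg_left (Real.log_le_sub_one_of_pos (div_pos hq hr)) (hM.1 _).le
        _ = _ := by
          rw [hm]
          field_simp
    _ = 0 := by
      rw [← Finset.mul_sum, Finset.sum_sub_distrib, (hQ z).2, (hR z).2, sub_self, mul_zero]

lemma sum_mul_sub_DcSet_le_sup' [Nonempty Y] [Nonempty F] {P : F → (Fin (n + 1) → Y) → ℝ}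
    (hP : ∀ φ, IsModel (P φ))
    (G : Finset F) (hG : G.Nonempty) {π : F → ℝ} (hπ : IsPrior π)
    {Q : (Fin n → Y) → Y → ℝ} (hQ : IsPredictor Q) :
    (∑ φ, π φ * (DcPred (P φ) (mixPred P π) - DcSet P G hG (P φ))) ≤
      Finset.univ.sup' Finset.univ_nonempty fun φ =>
        G.sup' hG fun θ => regretN (P φ) (P θ) Q := by
  simp only [sup'_regretN_eq hP G hG hQ]
  set s := Finset.univ.sup' Finset.univ_nonempty fun φ => DcPred (P φ) Q - DcSet P G hG (P φ)
  calc
    _ ≤ ∑ φ, π φ * (DcPred (P φ) Q - DcSet P G hG (P φ)) := by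
      simp only [mul_sub, Finset.sum_sub_distrib]
      exact sub_le_sub_right (sum_DcPred_mixPred_le hP hπ hQ) _
    _ ≤ ∑ φ, π φ * s := Finset.sum_le_sum fun φ _ => mul_le_mul_of_nonneg_left
      (Finset.le_sup' (fun φ => DcPred (P φ) Q - DcSet P G hG (P φ)) (Finset.mem_univ φ)) (hπ.1 φ)
    _ = s := by rw [← Finset.sum_mul, hπ.2, one_mul]

end Mixture

variable {Y F : Type*} [Fintype Y] [Nonempty Y] [Fintype F] [Nonempty F] {n : ℕ}

/-- Theorem 3: Arimoto–Blahut bounds `R_L ≤ R*_N(Θ, Φ) ≤ R_U`. -/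
theorem arimoto_blahut_bounds
    (P : F → (Fin (n + 1) → Y) → ℝ) (hP : ∀ φ, IsModel (P φ))
    (G : Finset F) (hG : G.Nonempty)
    (π : F → ℝ) (hπ : IsPrior π) :
    (∑ φ, π φ * (DcPred (P φ) (mixPred P π) - DcSet P G hG (P φ))) ≤ Rstar P G hG ∧
    Rstar P G hG ≤ Finset.univ.sup' Finset.univ_nonempty
      (fun φ => DcPred (P φ) (mixPred P π) - DcSet P G hG (P φ)) := by
  have hR := mixPred_isPredictor hP hπ
  constructor
  · refine le_csInf ⟨_, mixPred P π, hR, rfl⟩ ?_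
    rintro _ ⟨Q, hQ, rfl⟩
    exact sum_mul_sub_DcSet_le_sup' hP G hG hπ hQ
  · simp only [← sup'_regretN_eq hP G hG hR]
    refine csInf_le ⟨∑ φ, π φ * (DcPred (P φ) (mixPred P π) - DcSet P G hG (P φ)), ?_⟩
      ⟨mixPred P π, hR, rfl⟩
    rintro _ ⟨Q, hQ, rfl⟩
    exact sum_mul_sub_DcSet_le_sup' hP G hG hπ hQ
end
end

section
/- (Corollary, combined Arimoto-Blahut bounds) For every prior π on F, (1/L) Σ_φ π(φ) ( D_{c,N,L}(P_φ ‖ Q_π) − D_{c,N,L}(P_φ ‖ Θ) ) ≤ R*_{N,L}(Θ, Φ) ≤ (1/L) max_{φ in F} ( D_{c,N,L}(P_φ ‖ Q_π) − D_{c,N,L}(P_φ ‖ Θ) ). -/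
/-!
Combined batch-and-online setting: sequences of length `N + L` over a nonempty
finite alphabet `Y` are encoded as pairs `(y^N, y^L) : (Fin N → Y) × (Fin L → Y)`
of the first `N` coordinates and the last `L` coordinates.
-/

noncomputable section

/-- A model: a strictly positive probability function on `Y^(N+L)`. -/
def IsModelNL {Y : Type*} [Fintype Y] {N L : ℕ}
    (P : (Fin N → Y) × (Fin L → Y) → ℝ) : Prop :=
  (∀ y, 0 < P y) ∧ (∑ y, P y) = 1

/-- An `L`-predictor: to every `y^N` it assigns a strictly positive probability
function on `Y^L`. -/
def IsLPredictor {Y : Type*} [Fintype Y] {N L : ℕ}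
    (Q : (Fin N → Y) → (Fin L → Y) → ℝ) : Prop :=
  ∀ z, (∀ w, 0 < Q z w) ∧ (∑ w, Q z w) = 1

/-- Marginal probability `P(y^N)` of the first `N` coordinates. -/
def margNL {Y : Type*} [Fintype Y] {N L : ℕ}
    (P : (Fin N → Y) × (Fin L → Y) → ℝ) (z : Fin N → Y) : ℝ :=
  ∑ w : Fin L → Y, P (z, w)

/-- Conditional probability `P(y^L | y^N) = P(y^{N+L}) / P(y^N)`. -/
def condNL {Y : Type*} [Fintype Y] {N L : ℕ}
    (P : (Fin N → Y) × (Fin L → Y) → ℝ) (y : (Fin N → Y) × (Fin L → Y)) : ℝ :=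
  P y / margNL P y.1

/-- The conditional KL divergence `D_{c,N,L}(P ‖ Q)` of a model `P` from an
`L`-predictor `Q`. -/
def DcNL {Y : Type*} [Fintype Y] {N L : ℕ}
    (P : (Fin N → Y) × (Fin L → Y) → ℝ)
    (Q : (Fin N → Y) → (Fin L → Y) → ℝ) : ℝ :=
  ∑ y, P y * Real.log (condNL P y / Q y.1 y.2)

/-- The conditional KL divergence of a model `P` from another model `P'`. -/
def DcNLmodel {Y : Type*} [Fintype Y] {N L : ℕ}
    (P P' : (Fin N → Y) × (Fin L → Y) → ℝ) : ℝ :=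
  ∑ y, P y * Real.log (condNL P y / condNL P' y)

/-- The normalized block regret
`(1/L) Σ_{y^{N+L}} P_φ(y^{N+L}) log( P_θ(y^L|y^N) / Q(y^L|y^N) )`. -/
def regretNL {Y : Type*} [Fintype Y] {N L : ℕ}
    (Pφ Pθ : (Fin N → Y) × (Fin L → Y) → ℝ)
    (Q : (Fin N → Y) → (Fin L → Y) → ℝ) : ℝ :=
  (1 / (L : ℝ)) * ∑ y, Pφ y * Real.log (condNL Pθ y / Q y.1 y.2)

/-- Conditional divergence of a model from the hypothesis class
`Θ = {P θ : θ ∈ G}`. -/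
def DcSetNL {Y F : Type*} [Fintype Y] [Fintype F] {N L : ℕ}
    (P : F → (Fin N → Y) × (Fin L → Y) → ℝ) (G : Finset F) (hG : G.Nonempty)
    (Pφ : (Fin N → Y) × (Fin L → Y) → ℝ) : ℝ :=
  G.inf' hG fun θ => DcNLmodel Pφ (P θ)

/-- The mixture `L`-predictor
`Q_π(y^L | y^N) = (Σ_φ π(φ) P_φ(y^{N+L})) / (Σ_φ π(φ) P_φ(y^N))`. -/
def mixPredNL {Y F : Type*} [Fintype Y] [Fintype F] {N L : ℕ}
    (P : F → (Fin N → Y) × (Fin L → Y) → ℝ) (π : F → ℝ) :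
    (Fin N → Y) → (Fin L → Y) → ℝ :=
  fun z w => (∑ φ, π φ * P φ (z, w)) / (∑ φ, π φ * margNL (P φ) z)

/-- `I_π(Y^L; Φ | Y^N)`. -/
def mutualInfoNL {Y F : Type*} [Fintype Y] [Fintype F] {N L : ℕ}
    (P : F → (Fin N → Y) × (Fin L → Y) → ℝ) (π : F → ℝ) : ℝ :=
  ∑ φ, ∑ y, π φ * P φ y * Real.log (condNL (P φ) y / mixPredNL P π y.1 y.2)

/-- The combined min-max regret
`R*_{N,L}(Θ, Φ) = inf_Q max_{φ ∈ F} max_{θ ∈ G} (1/L) Σ P_φ log(P_θ(y^L|y^N)/Q(y^L|y^N))`. -/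
def RstarNL {Y F : Type*} [Fintype Y] [Fintype F] [Nonempty F] {N L : ℕ}
    (P : F → (Fin N → Y) × (Fin L → Y) → ℝ) (G : Finset F) (hG : G.Nonempty) : ℝ :=
  sInf {r : ℝ | ∃ Q, IsLPredictor Q ∧
    r = Finset.univ.sup' Finset.univ_nonempty fun φ =>
          G.sup' hG fun θ => regretNL (P φ) (P θ) Q}

variable {Y F : Type*} [Fintype Y] [Nonempty Y] [Fintype F] [Nonempty F] {N L : ℕ}

theorem margNL_pos {P : (Fin N → Y) × (Fin L → Y) → ℝ} (hP : IsModelNL P)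
    (z : Fin N → Y) : 0 < margNL P z :=
  Finset.sum_pos (fun w _ => hP.1 (z, w)) Finset.univ_nonempty

theorem condNL_pos {P : (Fin N → Y) × (Fin L → Y) → ℝ} (hP : IsModelNL P)
    (y : (Fin N → Y) × (Fin L → Y)) : 0 < condNL P y :=
  div_pos (hP.1 y) (margNL_pos hP y.1)

/-- A prior average of positive numbers is positive. -/
theorem IsPrior.sum_mul_pos {F : Type*} [Fintype F] {π f : F → ℝ} (hπ : IsPrior π)
    (hf : ∀ φ, 0 < f φ) : 0 < ∑ φ, π φ * f φ := by
  obtain ⟨φ, -, hφ⟩ : ∃ φ ∈ Finset.univ, (0 : ℝ) < π φ :=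
    Finset.exists_lt_of_sum_lt (by simp [hπ.2])
  exact Finset.sum_pos' (fun φ _ => mul_nonneg (hπ.1 φ) (hf φ).le)
    ⟨φ, Finset.mem_univ φ, mul_pos hφ (hf φ)⟩

omit [Nonempty Y] in
theorem sum_mul_margNL {F : Type*} [Fintype F] (P : F → (Fin N → Y) × (Fin L → Y) → ℝ)
    (π : F → ℝ) (z : Fin N → Y) :
    ∑ w, ∑ φ, π φ * P φ (z, w) = ∑ φ, π φ * margNL (P φ) z := by
  rw [Finset.sum_comm]
  simp only [margNL, Finset.mul_sum]

omit [Nonempty F] in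
theorem isLPredictor_mixPredNL {P : F → (Fin N → Y) × (Fin L → Y) → ℝ}
    (hP : ∀ φ, IsModelNL (P φ)) {π : F → ℝ} (hπ : IsPrior π) :
    IsLPredictor (mixPredNL P π) := by
  intro z
  have hm : 0 < ∑ φ, π φ * margNL (P φ) z := hπ.sum_mul_pos fun φ => margNL_pos (hP φ) z
  refine ⟨fun w => div_pos (hπ.sum_mul_pos fun φ => (hP φ).1 (z, w)) hm, ?_⟩
  simp only [mixPredNL]
  rw [← Finset.sum_div, sum_mul_margNL, div_self hm.ne']

theorem regretNL_eq {Pφ Pθ : (Fin N → Y) × (Fin L → Y) → ℝ} (hφ : IsModelNL Pφ)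
    (hθ : IsModelNL Pθ) {Q : (Fin N → Y) → (Fin L → Y) → ℝ} (hQ : IsLPredictor Q) :
    regretNL Pφ Pθ Q = (1 / (L : ℝ)) * (DcNL Pφ Q - DcNLmodel Pφ Pθ) := by
  simp only [regretNL, DcNL, DcNLmodel]
  rw [← Finset.sum_sub_distrib]
  congr 1
  refine Finset.sum_congr rfl fun y _ => ?_
  have h1 := (condNL_pos hφ y).ne'
  have h2 := (condNL_pos hθ y).ne'
  have h3 := ((hQ y.1).1 y.2).ne'
  rw [Real.log_div h2 h3, Real.log_div h1 h3, Real.log_div h1 h2]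
  ring

omit [Nonempty F] in
theorem sup'_regretNL {P : F → (Fin N → Y) × (Fin L → Y) → ℝ}
    (hP : ∀ φ, IsModelNL (P φ)) {G : Finset F} (hG : G.Nonempty)
    {Q : (Fin N → Y) → (Fin L → Y) → ℝ} (hQ : IsLPredictor Q) (φ : F) :
    (G.sup' hG fun θ => regretNL (P φ) (P θ) Q) =
      (1 / (L : ℝ)) * (DcNL (P φ) Q - DcSetNL P G hG (P φ)) := by
  have hL0 : (0 : ℝ) ≤ 1 / L := by positivity
  apply le_antisymm
  · refine Finset.sup'_le _ _ fun θ hθ => ?_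
    rw [regretNL_eq (hP φ) (hP θ) hQ]
    have : DcSetNL P G hG (P φ) ≤ DcNLmodel (P φ) (P θ) :=
      Finset.inf'_le (fun θ => DcNLmodel (P φ) (P θ)) hθ
    gcongr
  · obtain ⟨θ, hθ, h⟩ := Finset.exists_mem_eq_inf' hG fun θ => DcNLmodel (P φ) (P θ)
    rw [DcSetNL, h, ← regretNL_eq (hP φ) (hP θ) hQ]
    exact Finset.le_sup' (fun θ => regretNL (P φ) (P θ) Q) hθ

omit [Nonempty F] in
/-- The mixture predictor minimizes the prior average of the conditional divergence. -/
theorem sum_DcNL_mixPredNL_le {P : F → (Fin N → Y) × (Fin L → Y) → ℝ}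
    (hP : ∀ φ, IsModelNL (P φ)) {π : F → ℝ} (hπ : IsPrior π)
    {Q : (Fin N → Y) → (Fin L → Y) → ℝ} (hQ : IsLPredictor Q) :
    ∑ φ, π φ * DcNL (P φ) (mixPredNL P π) ≤ ∑ φ, π φ * DcNL (P φ) Q := by
  have hR := isLPredictor_mixPredNL hP hπ
  rw [← sub_nonpos, ← Finset.sum_sub_distrib]
  calc ∑ φ, (π φ * DcNL (P φ) (mixPredNL P π) - π φ * DcNL (P φ) Q)
      = ∑ y : (Fin N → Y) × (Fin L → Y),
          (∑ φ, π φ * P φ y) * Real.log (Q y.1 y.2 / mixPredNL P π y.1 y.2) := by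
        simp only [DcNL, Finset.mul_sum, Finset.sum_mul, ← Finset.sum_sub_distrib]
        rw [Finset.sum_comm]
        refine Finset.sum_congr rfl fun y _ => Finset.sum_congr rfl fun φ _ => ?_
        have h1 := (condNL_pos (hP φ) y).ne'
        have h2 := ((hQ y.1).1 y.2).ne'
        have h3 := ((hR y.1).1 y.2).ne'
        rw [Real.log_div h1 h3, Real.log_div h1 h2, Real.log_div h2 h3]
        ring
    _ ≤ ∑ y : (Fin N → Y) × (Fin L → Y),
          ((∑ φ, π φ * margNL (P φ) y.1) * Q y.1 y.2 - ∑ φ, π φ * P φ y) := by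
        refine Finset.sum_le_sum fun y _ => ?_
        have hM : 0 < ∑ φ, π φ * P φ y := hπ.sum_mul_pos fun φ => (hP φ).1 y
        have hm : 0 < ∑ φ, π φ * margNL (P φ) y.1 :=
          hπ.sum_mul_pos fun φ => margNL_pos (hP φ) y.1
        refine (mul_le_mul_of_nonneg_left (Real.log_le_sub_one_of_pos
          (div_pos ((hQ y.1).1 y.2) ((hR y.1).1 y.2))) hM.le).trans_eq ?_
        simp only [mixPredNL]
        field_simp
    _ = 0 := by
        rw [Fintype.sum_prod_type]
        refine Finset.sum_eq_zero fun z _ => ?_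
        dsimp only
        rw [Finset.sum_sub_distrib, ← Finset.mul_sum, (hQ z).2, sum_mul_margNL, mul_one, sub_self]

theorem sum_mul_sub_le_sup'_regretNL {P : F → (Fin N → Y) × (Fin L → Y) → ℝ}
    (hP : ∀ φ, IsModelNL (P φ)) {G : Finset F} (hG : G.Nonempty) {π : F → ℝ} (hπ : IsPrior π)
    {Q : (Fin N → Y) → (Fin L → Y) → ℝ} (hQ : IsLPredictor Q) :
    (1 / (L : ℝ)) * (∑ φ, π φ * (DcNL (P φ) (mixPredNL P π) - DcSetNL P G hG (P φ))) ≤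
      Finset.univ.sup' Finset.univ_nonempty fun φ =>
        G.sup' hG fun θ => regretNL (P φ) (P θ) Q := by
  set S := Finset.univ.sup' Finset.univ_nonempty fun φ =>
    G.sup' hG fun θ => regretNL (P φ) (P θ) Q
  have hL0 : (0 : ℝ) ≤ 1 / L := by positivity
  calc _ ≤ (1 / (L : ℝ)) * ∑ φ, π φ * (DcNL (P φ) Q - DcSetNL P G hG (P φ)) := by
        refine mul_le_mul_of_nonneg_left ?_ hL0
        simp only [mul_sub, Finset.sum_sub_distrib]
        exact sub_le_sub_right (sum_DcNL_mixPredNL_le hP hπ hQ) _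
    _ = ∑ φ, π φ * G.sup' hG fun θ => regretNL (P φ) (P θ) Q := by
        rw [Finset.mul_sum]
        refine Finset.sum_congr rfl fun φ _ => ?_
        rw [sup'_regretNL hP hG hQ]
        ring
    _ ≤ ∑ φ, π φ * S := by
        refine Finset.sum_le_sum fun φ _ => mul_le_mul_of_nonneg_left ?_ (hπ.1 φ)
        exact Finset.le_sup' (fun φ => G.sup' hG fun θ => regretNL (P φ) (P θ) Q)
          (Finset.mem_univ φ)
    _ = S := by rw [← Finset.sum_mul, hπ.2, one_mul]

/-- Corollary, combined Arimoto–Blahut bounds: for every prior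
`π` on `F`,
`(1/L) Σ_φ π(φ)(D_{c,N,L}(P_φ ‖ Q_π) − D_{c,N,L}(P_φ ‖ Θ)) ≤ R*_{N,L}(Θ, Φ)
  ≤ (1/L) max_φ (D_{c,N,L}(P_φ ‖ Q_π) − D_{c,N,L}(P_φ ‖ Θ))`. -/
theorem combined_arimoto_blahut_bounds
    (hL : 0 < L)
    (P : F → (Fin N → Y) × (Fin L → Y) → ℝ) (hP : ∀ φ, IsModelNL (P φ))
    (G : Finset F) (hG : G.Nonempty)
    (π : F → ℝ) (hπ : IsPrior π) :
    (1 / (L : ℝ)) *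
        (∑ φ, π φ * (DcNL (P φ) (mixPredNL P π) - DcSetNL P G hG (P φ))) ≤
      RstarNL P G hG ∧
    RstarNL P G hG ≤
      (1 / (L : ℝ)) * Finset.univ.sup' Finset.univ_nonempty
        (fun φ => DcNL (P φ) (mixPredNL P π) - DcSetNL P G hG (P φ)) := by
  have hR := isLPredictor_mixPredNL hP hπ
  constructor
  · refine le_csInf ⟨_, mixPredNL P π, hR, rfl⟩ ?_
    rintro r ⟨Q, hQ, rfl⟩
    exact sum_mul_sub_le_sup'_regretNL hP hG hπ hQ
  · refine le_trans (csInf_le ⟨(1 / (L : ℝ)) *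
        (∑ φ, π φ * (DcNL (P φ) (mixPredNL P π) - DcSetNL P G hG (P φ))), ?_⟩
      ⟨mixPredNL P π, hR, rfl⟩) ?_
    · rintro r ⟨Q, hQ, rfl⟩
      exact sum_mul_sub_le_sup'_regretNL hP hG hπ hQ
    · refine Finset.sup'_le _ _ fun φ _ => ?_
      rw [sup'_regretNL hP hG hR]
      refine mul_le_mul_of_nonneg_left ?_ (by positivity)
      exact Finset.le_sup' (fun φ => DcNL (P φ) (mixPredNL P π) - DcSetNL P G hG (P φ))
        (Finset.mem_univ φ)
end
end
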